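/- Let p > 5 be prime and let A be a brace of cardinality p^4 with (A,+) ≅ C_{p^2} × C_{p^2}, whose group (A,∘) is generated by elements P, Q, R satisfying P^{p^2} = Q^p = R^p = 1, P∘Q = Q∘P, Q∘R = R∘Q, R^{-1}∘P∘R = P∘Q (powers and inverses in (A,∘)). Then A is right nilpotent. -/

import Mathlib

/-- A (left) brace: an abelian group `(A,+)` and a group `(A,∘)` (written `*`)
on the same underlying set, with `a∘(b+c)+a = a∘b+a∘c`; the identity of `(A,∘)`
coincides with `0`. -/
class Brace (A : Type*) extends AddCommGroup A, Group A where
  mul_add_left : ∀ a b c : A, a * (b + c) + a = a * b + a * c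
  one_eq_zero : (1 : A) = 0

namespace Brace

variable {A : Type*} [Brace A]

/-- The star operation `a ∗ b = a∘b - a - b`. -/
def bstar (a b : A) : A := a * b - a - b

/-- `X ∗ Y`: the additive subgroup generated by `{x∗y : x ∈ X, y ∈ Y}`. -/
def starSpan (A : Type*) [Brace A] (X Y : Set A) : AddSubgroup A :=
  AddSubgroup.closure {z : A | ∃ x ∈ X, ∃ y ∈ Y, z = bstar x y}

/-- `A² = A ∗ A`. -/
def sq (A : Type*) [Brace A] : AddSubgroup A := starSpan A Set.univ Set.univ

/-- `A³ = A ∗ A²`. -/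
def cube (A : Type*) [Brace A] : AddSubgroup A := starSpan A Set.univ (sq A : Set A)

/-- The right series: `rightSeries A 0 = A^(1) = A`, `rightSeries A (n+1) = A^(n+1+1) = A^(n+1) ∗ A`. -/
def rightSeries (A : Type*) [Brace A] : ℕ → AddSubgroup A
  | 0 => ⊤
  | n + 1 => starSpan A (rightSeries A n : Set A) Set.univ

/-- A brace is right nilpotent if `A^(n) = 0` for some `n`. -/
def RightNilpotent (A : Type*) [Brace A] : Prop := ∃ n : ℕ, rightSeries A n = ⊥

/-- `c ∈ Z(A)`: `c∗a = a∗c` for all `a`. -/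
def IsCentral (c : A) : Prop := ∀ a : A, bstar c a = bstar a c

end Brace

open Finset Polynomial in
/-- The sum `∑_{i<p} (1+t)^i` equals `p` times a unit when `t ^ 4 = 0` and `p ≥ 5` is prime. -/
theorem exists_unit_geom_sum_one_add {E : Type*} [Ring E] {p : ℕ} (hp : p.Prime) (hp5 : 5 ≤ p)
    {t : E} (ht : t ^ 4 = 0) : ∃ u : Eˣ, ∑ i ∈ range p, (1 + t) ^ i = u * p := by
  let S : ℤ[X] := ∑ i ∈ range (p - 2), C ((p.choose (i + 2) / p : ℕ) : ℤ) * X ^ i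
  have key : ∑ i ∈ range p, (X + 1 : ℤ[X]) ^ i = (1 + X * S) * (p : ℤ[X]) + X ^ (p - 1) := by
    have h := geom_sum_X_comp_X_add_one_eq_sum (R := ℤ) p
    simp only [Polynomial.comp, eval₂_finsetSum, eval₂_X_pow] at h
    rw [h]
    obtain ⟨n, rfl⟩ : ∃ n, p = n + 2 := ⟨p - 2, by lia⟩
    rw [sum_range_succ, sum_range_succ']
    have hS : ∑ i ∈ range n, (((n + 2).choose (i + 1 + 1) : ℕ) : ℤ[X]) * X ^ (i + 1)
        = X * S * ((n + 2 : ℕ) : ℤ[X]) := by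
      simp only [S, Finset.mul_sum, Finset.sum_mul]
      refine Finset.sum_congr (by simp) fun i hi => ?_
      have hd : n + 2 ∣ (n + 2).choose (i + 2) :=
        hp.dvd_choose_self (by simp) (by simp at hi; lia)
      obtain ⟨k, hk⟩ := hd
      have hk' : (n + 2).choose (i + 2) / (n + 2) = k := by
        rw [hk]; exact Nat.mul_div_cancel_left k (by lia)
      rw [show i + 1 + 1 = i + 2 from rfl, hk', hk]
      simp only [Nat.cast_mul, map_natCast]
      ring
    rw [hS]
    simp
    ring
  have hE := congrArg (aeval t) key
  simp only [map_sum, map_pow, map_add, map_mul, aeval_X, map_one, map_natCast] at hE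
  have hz : t ^ (p - 1) = 0 := pow_eq_zero_of_le (by lia) ht
  have hnil : IsNilpotent (t * aeval t S) := by
    have hc : Commute t (aeval t S) := by
      have := (Commute.all (X : ℤ[X]) S).map (aeval t)
      rwa [aeval_X] at this
    exact ⟨4, by rw [hc.mul_pow, ht, zero_mul]⟩
  obtain ⟨u, hu⟩ := hnil.isUnit_one_add
  refine ⟨u, ?_⟩
  rw [hz, add_zero] at hE
  rw [hu, ← hE]
  simp only [add_comm]

/-- An endomorphism of order `p` of a vector space of dimension at most two over `ZMod p` is
unipotent of degree two. -/
theorem Module.End.sub_one_pow_two_eq_zero {V : Type*} [AddCommGroup V] {p : ℕ} [Fact p.Prime]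
    [Module (ZMod p) V] [Module.Finite (ZMod p) V] (hcard : Nat.card V ≤ p ^ 2)
    (g : Module.End (ZMod p) V) (hg : g ^ p = 1) : (g - 1) ^ 2 = 0 := by
  have hfin : Module.finrank (ZMod p) V ≤ 2 := by
    rw [Module.natCard_eq_pow_finrank (K := ZMod p) (V := V), Nat.card_zmod] at hcard
    exact (Nat.pow_le_pow_iff_right (Fact.out : p.Prime).one_lt).1 hcard
  have hnil : (g - 1) ^ p = 0 := by
    have hc : Commute (g - 1) 1 := Commute.one_right _
    obtain ⟨r, hr⟩ := hc.exists_add_pow_prime_eq (Fact.out : p.Prime)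
    have hp0 : (p : Module.End (ZMod p) V) = 0 := by
      rw [← map_natCast (algebraMap (ZMod p) (Module.End (ZMod p) V)), ZMod.natCast_self, map_zero]
    simpa [hg, hp0] using hr.symm
  have hch : (g - 1).charpoly = Polynomial.X ^ Module.finrank (ZMod p) V :=
    (LinearMap.charpoly_eq_X_pow_iff _).2 fun m => ⟨p, by rw [hnil]; rfl⟩
  have h0 := LinearMap.aeval_self_charpoly (g - 1)
  rw [hch, map_pow, Polynomial.aeval_X] at h0
  exact pow_eq_zero_of_le hfin h0

/-- An endomorphism of order `p` of an elementary abelian `p`-group of rank at most two is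
unipotent of degree two. -/
theorem sub_one_pow_two_eq_zero_of_pow_prime_eq_one {V : Type*} [AddCommGroup V] [Finite V] {p : ℕ}
    (hp : p.Prime) (hV : ∀ v : V, p • v = 0) (hcard : Nat.card V ≤ p ^ 2)
    (f : V →+ V) (hf : ∀ v, f^[p] v = v) (v : V) : f (f v - v) - (f v - v) = 0 := by
  have : Fact p.Prime := ⟨hp⟩
  have : Module (ZMod p) V := AddCommGroup.zmodModule hV
  have : Module.Finite (ZMod p) V := Module.Finite.of_finite
  have h2 := Module.End.sub_one_pow_two_eq_zero hcard (f.toZModLinearMap p) (by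
    ext w
    rw [Module.End.pow_apply]
    exact hf w)
  rw [pow_two] at h2
  exact LinearMap.congr_fun h2 v

theorem ZMod.card_nsmul_eq_zero_le (n k : ℕ) [NeZero n] (hk : 0 < k) :
    Nat.card {z : ZMod n // k • z = 0} ≤ k := by
  classical
  rw [Nat.card_eq_fintype_card, Fintype.card_subtype]
  exact IsAddCyclic.card_nsmul_eq_zero_le hk

theorem card_torsionBy_le_of_addEquiv {A : Type*} [AddCommGroup A] {n k : ℕ} [NeZero n]
    (hk : 0 < k) (e : A ≃+ ZMod n × ZMod n) : Nat.card (AddSubgroup.torsionBy A (k : ℤ)) ≤ k ^ 2 := by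
  have hmem (x : AddSubgroup.torsionBy A (k : ℤ)) : k • e x = 0 := by
    rw [← map_nsmul, AddSubgroup.torsionBy.nsmul_iff.1 x.2, map_zero]
  let F : AddSubgroup.torsionBy A (k : ℤ) → {z : ZMod n // k • z = 0} × {z : ZMod n // k • z = 0} :=
    fun x => (⟨(e x).1, congrArg Prod.fst (hmem x)⟩, ⟨(e x).2, congrArg Prod.snd (hmem x)⟩)
  have hF : Function.Injective F := fun x y hxy => by
    simp only [F, Prod.mk.injEq, Subtype.mk.injEq] at hxy
    exact Subtype.ext (e.injective (Prod.ext hxy.1 hxy.2))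
  refine (Nat.card_le_card_of_injective F hF).trans ?_
  rw [Nat.card_prod, pow_two]
  exact Nat.mul_le_mul (ZMod.card_nsmul_eq_zero_le n k hk) (ZMod.card_nsmul_eq_zero_le n k hk)

namespace Brace

variable {A : Type*} [Brace A]

/-- The action `λ_a(b) = a∘b - a` of the multiplicative group on the additive group. -/
def lam : A →* AddMonoid.End A where
  toFun a :=
    { toFun := fun b => a * b - a
      map_zero' := by
        rw [sub_eq_zero]
        simpa only [one_eq_zero] using mul_one a
      map_add' := fun b c => by
        rw [eq_sub_of_add_eq (mul_add_left a b c)]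
        abel }
  map_one' := by
    ext b
    change 1 * b - 1 = b
    rw [one_mul, one_eq_zero, sub_zero]
  map_mul' a b := by
    ext c
    change a * b * c - a * b = a * (b * c - b) - a
    have h := mul_add_left a (b * c - b) b
    rw [sub_add_cancel] at h
    rw [eq_sub_of_add_eq h.symm, ← mul_assoc]
    abel

theorem lam_apply (a b : A) : lam a b = a * b - a := rfl

theorem pow_eq_sum_lam (x : A) (n : ℕ) : x ^ n = (∑ i ∈ Finset.range n, lam x ^ i) x := by
  induction n with
  | zero => simp [one_eq_zero]
  | succ n ih =>
    have h : x ^ (n + 1) = lam x (x ^ n) + x := by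
      rw [lam_apply, pow_succ', sub_add_cancel]
    rw [h, ih, Finset.sum_range_succ', pow_zero]
    change _ = (∑ i ∈ Finset.range n, lam x ^ (i + 1)) x + x
    simp only [pow_succ', ← Finset.mul_sum]
    rfl

/-- In a brace whose additive group is `C_{p²} × C_{p²}` with `p ≥ 5`, elements of multiplicative
order dividing `p` have additive order dividing `p`. -/
theorem nsmul_eq_zero_of_pow_eq_one {p : ℕ} (hp : p.Prime) (hp5 : 5 ≤ p)
    (e : A ≃+ ZMod (p ^ 2) × ZMod (p ^ 2)) {x : A} (hx : x ^ p = 1) : p • x = 0 := by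
  have : NeZero (p ^ 2) := ⟨pow_ne_zero _ hp.ne_zero⟩
  have : Finite A := Finite.of_equiv _ e.symm.toEquiv
  have hpp (a : A) : p • p • a = 0 := by
    apply e.injective
    have h0 : ((p ^ 2 : ℕ) : ZMod (p ^ 2)) = 0 := ZMod.natCast_self _
    rw [smul_smul, ← pow_two, map_nsmul, map_zero]
    ext
    · rw [Prod.smul_fst, nsmul_eq_mul, h0, zero_mul, Prod.fst_zero]
    · rw [Prod.smul_snd, nsmul_eq_mul, h0, zero_mul, Prod.snd_zero]
  set l := lam x with hl
  have hlp : l ^ p = 1 := by rw [hl, ← map_pow, hx, map_one]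
  have hit (a : A) : l^[p] a = a := by
    have := DFunLike.congr_fun hlp a
    rwa [AddMonoid.End.coe_pow] at this
  let W := AddSubgroup.torsionBy A (p : ℤ)
  have hW (a : A) : a ∈ W ↔ p • a = 0 := AddSubgroup.torsionBy.nsmul_iff
  have hlW (a : A) (ha : a ∈ W) : l a ∈ W := by
    rw [hW] at ha ⊢
    rw [← map_nsmul, ha, map_zero]
  let f : W →+ W := AddMonoidHom.codRestrict (AddMonoidHom.domRestrict l W) W fun a => hlW a a.2
  have hfi (n : ℕ) (w : W) : (f^[n] w : A) = l^[n] w := by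
    induction n with
    | zero => rfl
    | succ n ih => rw [Function.iterate_succ_apply', Function.iterate_succ_apply', ← ih]; rfl
  have hsq (a : A) (ha : p • a = 0) : ((l - 1) ^ 2 : AddMonoid.End A) a = 0 := by
    have := sub_one_pow_two_eq_zero_of_pow_prime_eq_one hp (fun w : W => AddSubgroup.torsionBy.nsmul w)
      (card_torsionBy_le_of_addEquiv hp.pos e) f (fun w => Subtype.ext ((hfi p w).trans (hit w)))
      ⟨a, (hW a).2 ha⟩
    rw [pow_two]
    exact congrArg Subtype.val this
  have h4 : (l - 1) ^ 4 = 0 := by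
    ext a
    rw [show 4 = 2 + 2 from rfl, pow_add]
    refine hsq (((l - 1) ^ 2 : AddMonoid.End A) a) ?_
    rw [← map_nsmul]
    exact hsq _ (hpp a)
  obtain ⟨u, hu⟩ := exists_unit_geom_sum_one_add hp hp5 h4
  have hsum := pow_eq_sum_lam x p
  rw [hx, one_eq_zero, ← hl] at hsum
  rw [add_sub_cancel] at hu
  rw [hu] at hsum
  have h0 : (↑u⁻¹ : AddMonoid.End A) ((u * (p : AddMonoid.End A)) x) = 0 := by
    rw [← hsum, map_zero]
  change ((↑u⁻¹ : AddMonoid.End A) * (u * (p : AddMonoid.End A))) x = 0 at h0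
  rwa [Units.inv_mul_cancel_left] at h0

end Brace

/-- In a group generated by `P, Q, R` with `Q` central and `R⁻¹PR = PQ`, every element has the form
`R^c Q^b P^a`. -/
theorem exists_eq_zpow_mul_zpow_mul_zpow {G : Type*} [Group G] {P Q R : G}
    (hgen : Subgroup.closure ({P, Q, R} : Set G) = ⊤) (hPQ : P * Q = Q * P) (hQR : Q * R = R * Q)
    (hRP : R⁻¹ * P * R = P * Q) (g : G) : ∃ a b c : ℤ, g = R ^ c * Q ^ b * P ^ a := by
  have hQRc : Commute Q R := hQR
  have hPQc : Commute P Q := hPQ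
  have hPR : P * R = R * Q * P := by
    rw [mul_assoc, ← hPQ, ← hRP]; group
  have h1 (c : ℤ) : P * R ^ c = R ^ c * Q ^ c * P := by
    have h : SemiconjBy P R (R * Q) := hPR
    have := h.zpow_right c
    rwa [hQRc.symm.mul_zpow] at this
  have h2 (c : ℤ) : P⁻¹ * R ^ c = R ^ c * Q ^ (-c) * P⁻¹ := by
    have h := h1 c
    have hc : P * Q ^ (-c) = Q ^ (-c) * P := (hPQc.zpow_right (-c)).eq
    rw [inv_mul_eq_iff_eq_mul, ← mul_assoc, ← mul_assoc, h, mul_assoc (R ^ c * Q ^ c), hc]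
    group
  have hg : g ∈ Subgroup.closure ({P, Q, R} : Set G) := by rw [hgen]; trivial
  induction hg using Subgroup.closure_induction_left with
  | one => exact ⟨0, 0, 0, by simp⟩
  | mul_left x hx y _ ih =>
    obtain ⟨a, b, c, rfl⟩ := ih
    rcases hx with rfl | rfl | rfl
    · refine ⟨a + 1, c + b, c, ?_⟩
      have hc := (hPQc.zpow_right b).eq
      rw [← mul_assoc, ← mul_assoc, h1, mul_assoc _ x, hc, zpow_add, add_comm a, zpow_add, zpow_one]
      simp only [mul_assoc]
    · refine ⟨a, b + 1, c, ?_⟩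
      have hc := (hQRc.zpow_right c).eq
      rw [← mul_assoc, ← mul_assoc, hc, add_comm b, zpow_add, zpow_one]
      simp only [mul_assoc]
    · refine ⟨a, b, c + 1, ?_⟩
      rw [add_comm c, zpow_add, zpow_one]
      simp only [mul_assoc]
  | inv_mul_cancel x hx y _ ih =>
    obtain ⟨a, b, c, rfl⟩ := ih
    rcases hx with rfl | rfl | rfl
    · refine ⟨-1 + a, -c + b, c, ?_⟩
      have hc := (hPQc.inv_left.zpow_right b).eq
      rw [← mul_assoc, ← mul_assoc, h2, mul_assoc _ x⁻¹, hc, zpow_add, zpow_add, zpow_neg_one]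
      simp only [mul_assoc]
    · refine ⟨a, -1 + b, c, ?_⟩
      have hc := (hQRc.inv_left.zpow_right c).eq
      rw [← mul_assoc, ← mul_assoc, hc, zpow_add, zpow_neg_one]
      simp only [mul_assoc]
    · refine ⟨a, b, -1 + c, ?_⟩
      rw [zpow_add, zpow_neg_one]
      simp only [mul_assoc]

/-- Every element is a solution of `s ^ p = 1` times `P ^ i` with `i < p`. -/
theorem exists_pow_eq_one_mul_pow {G : Type*} [Group G] {P Q R : G} {p : ℕ} (hp : 0 < p)
    (hgen : Subgroup.closure ({P, Q, R} : Set G) = ⊤)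
    (hP : P ^ (p ^ 2) = 1) (hQ : Q ^ p = 1) (hR : R ^ p = 1)
    (hPQ : P * Q = Q * P) (hQR : Q * R = R * Q) (hRP : R⁻¹ * P * R = P * Q) (g : G) :
    ∃ s : G, s ^ p = 1 ∧ ∃ i : Fin p, s * P ^ (i : ℕ) = g := by
  obtain ⟨a, b, c, rfl⟩ := exists_eq_zpow_mul_zpow_mul_zpow hgen hPQ hQR hRP g
  have hQRc : Commute Q R := hQR
  have hPQc : Commute P Q := hPQ
  have hPR : SemiconjBy R (P * Q) P := by
    change R * (P * Q) = P * R
    rw [← hRP]; group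
  have hPpR : Commute R (P ^ p) := by
    have h := hPR.pow_right p
    rwa [hPQc.mul_pow, hQ, mul_one] at h
  have hp' : (0 : ℤ) < p := by exact_mod_cast hp
  have hnn := Int.emod_nonneg a hp'.ne'
  have hlt := Int.emod_lt_of_pos a hp'
  have key {x : G} (hx : x ^ p = 1) (n : ℤ) : (x ^ n) ^ p = 1 := by
    rw [← zpow_natCast, zpow_comm, zpow_natCast, hx, one_zpow]
  refine ⟨R ^ c * Q ^ b * (P ^ p) ^ (a / p), ?_, ⟨(a % p).toNat, by lia⟩, ?_⟩
  · have hc1 : Commute (R ^ c) (Q ^ b) := hQRc.symm.zpow_zpow c b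
    have hc2 : Commute (R ^ c * Q ^ b) ((P ^ p) ^ (a / p)) :=
      (hPpR.zpow_zpow c _).mul_left ((hPQc.symm.pow_right p).zpow_zpow b _)
    rw [hc2.mul_pow, hc1.mul_pow, key hR, key hQ, key (by rw [← pow_mul, ← pow_two, hP])]
    simp
  · rw [mul_assoc _ _ (P ^ _), ← zpow_natCast P p, ← zpow_mul, ← zpow_natCast, ← zpow_add]
    simp only [Int.toNat_of_nonneg hnn, Int.mul_ediv_add_emod]

/-- braces of cardinality p^4 with additive group C_{p^2} × C_{p^2} and
multiplicative group X are right nilpotent. -/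
theorem braceX_right_nilpotent (p : ℕ) (hp : p.Prime) (hp5 : 5 < p)
    (A : Type*) [Brace A] (hcard : Nat.card A = p ^ 4)
    (hadd : Nonempty (A ≃+ ZMod (p ^ 2) × ZMod (p ^ 2)))
    (P Q R : A) (hgen : Subgroup.closure ({P, Q, R} : Set A) = ⊤)
    (hP : P ^ (p ^ 2) = 1) (hQ : Q ^ p = 1) (hR : R ^ p = 1)
    (hPQ : P * Q = Q * P) (hQR : Q * R = R * Q)
    (hRP : R⁻¹ * P * R = P * Q) :
    Brace.RightNilpotent A := by
  exfalso
  obtain ⟨e⟩ := hadd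
  have : NeZero (p ^ 2) := ⟨pow_ne_zero _ hp.ne_zero⟩
  have : Finite A := Finite.of_equiv _ e.symm.toEquiv
  let F : AddSubgroup.torsionBy A (p : ℤ) × Fin p → A := fun z => (z.1 : A) * P ^ (z.2 : ℕ)
  have hF : Function.Surjective F := fun g => by
    obtain ⟨s, hs, i, hi⟩ := exists_pow_eq_one_mul_pow hp.pos hgen hP hQ hR hPQ hQR hRP g
    exact ⟨(⟨s, AddSubgroup.torsionBy.nsmul_iff.2
      (Brace.nsmul_eq_zero_of_pow_eq_one hp hp5.le e hs)⟩, i), hi⟩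
  have h1 := Nat.card_le_card_of_surjective F hF
  rw [hcard, Nat.card_prod, Nat.card_fin] at h1
  have h2 := Nat.mul_le_mul_right p (card_torsionBy_le_of_addEquiv hp.pos e)
  rw [← pow_succ] at h2
  exact absurd (h1.trans h2) (not_le.2 (Nat.pow_lt_pow_right hp.one_lt (by norm_num)))
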